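/- arXiv:2209.12666 — 8 statements merged into one kernel-verified Lean document; each statement's English description precedes it below -/
import Mathlib

section
/- Let n ≥ 1, let Φ be an invertible n×n real matrix, let Q be an n×n positive definite real matrix, and let Ω̂ be an n×n positive semidefinite real matrix. Then there exists a real constant γ̂ with 0 < γ̂ ≤ 1 such that for every n×n positive semidefinite real matrix Ω with Ω ⪯ Ω̂, the matrix Φ Ω Φᵀ + Q is positive definite (hence invertible) and (Φ Ω Φᵀ + Q)⁻¹ ⪰ γ̂ · Φ⁻ᵀ Ω Φ⁻¹. -/
open Matrix

/-- Inversion is antitone on positive definite real matrices for the Loewner order. -/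
theorem Matrix.PosDef.posSemidef_inv_sub_inv {m : Type*} [Fintype m] [DecidableEq m]
    {A B : Matrix m m ℝ} (hA : A.PosDef) (hB : B.PosDef) (h : (B - A).PosSemidef) :
    (A⁻¹ - B⁻¹).PosSemidef := by
  have := hB.isUnit.invertible
  have := hA.inv.isUnit.invertible
  have hblock : (fromBlocks B 1 1ᴴ A⁻¹).PosSemidef := by
    rw [PosDef.fromBlocks₂₂ B 1 hA.inv,
      nonsing_inv_nonsing_inv A ((isUnit_iff_isUnit_det A).1 hA.isUnit)]
    simpa using h
  simpa using (PosDef.fromBlocks₁₁ 1 A⁻¹ hB).1 hblock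

/-- Every real symmetric matrix is bounded above by a positive multiple of the identity. -/
theorem Matrix.IsHermitian.exists_pos_smul_one_sub_posSemidef {m : Type*} [Fintype m]
    [DecidableEq m] {A : Matrix m m ℝ} (hA : A.IsHermitian) :
    ∃ c : ℝ, 0 < c ∧ (c • (1 : Matrix m m ℝ) - A).PosSemidef := by
  refine ⟨∑ i, ∑ j, |A i j| + 1, by positivity, ?_⟩
  refine PosSemidef.of_dotProduct_mulVec_nonneg
    ((isHermitian_one.smul (IsSelfAdjoint.all _)).sub hA) fun x ↦ ?_
  have hle : x ⬝ᵥ A *ᵥ x ≤ (∑ i, ∑ j, |A i j|) * (x ⬝ᵥ x) := by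
    have hsq (i : m) : x i ^ 2 ≤ x ⬝ᵥ x := by
      rw [sq]
      exact Finset.single_le_sum (f := fun k ↦ x k * x k) (fun k _ ↦ mul_self_nonneg _)
        (Finset.mem_univ i)
    have hexp : x ⬝ᵥ A *ᵥ x = ∑ i, ∑ j, x i * (A i j * x j) := by
      simp only [dotProduct, mulVec, Finset.mul_sum]
    simp only [hexp, Finset.sum_mul]
    refine Finset.sum_le_sum fun i _ ↦ Finset.sum_le_sum fun j _ ↦ ?_
    have hxx : |x i * x j| ≤ x ⬝ᵥ x := by
      rw [abs_le]
      constructor <;> nlinarith [hsq i, hsq j, sq_nonneg (x i + x j), sq_nonneg (x i - x j)]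
    calc x i * (A i j * x j) ≤ |A i j * (x i * x j)| := by
          rw [mul_left_comm]; exact le_abs_self _
      _ = |A i j| * |x i * x j| := abs_mul _ _
      _ ≤ _ := by gcongr
  have hxx : 0 ≤ x ⬝ᵥ x := Finset.sum_nonneg fun k _ ↦ mul_self_nonneg _
  simp only [star_trivial, sub_mulVec, smul_mulVec, one_mulVec, dotProduct_sub, dotProduct_smul,
    smul_eq_mul]
  linarith

/-- Part (1) of the matrix-inversion lemma (Lemma 1): for an invertible `Φ`, a positive
definite `Q` and a positive semidefinite upper bound `Ωhat`, there is a constant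
`0 < γ̂ ≤ 1` such that `(Φ Ω Φᵀ + Q)⁻¹ ⪰ γ̂ • Φ⁻ᵀ Ω Φ⁻¹` for every positive
semidefinite `Ω ⪯ Ωhat`. -/
theorem stmt_0 (n : ℕ) (hn : 1 ≤ n)
    (Φ Q Ωhat : Matrix (Fin n) (Fin n) ℝ)
    (hΦ : IsUnit Φ.det) (hQ : Q.PosDef) (hΩhat : Ωhat.PosSemidef) :
    ∃ γ : ℝ, 0 < γ ∧ γ ≤ 1 ∧
      ∀ Om : Matrix (Fin n) (Fin n) ℝ, Om.PosSemidef → (Ωhat - Om).PosSemidef →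
        (Φ * Om * Φᵀ + Q).PosDef ∧
        ((Φ * Om * Φᵀ + Q)⁻¹ - γ • ((Φ⁻¹)ᵀ * Om * Φ⁻¹)).PosSemidef := by
  have hpos {M : Matrix (Fin n) (Fin n) ℝ} (hM : M.PosSemidef) : (Φ * M * Φᵀ + Q).PosDef :=
    PosDef.posSemidef_add (hM.mul_mul_conjTranspose_same Φ) hQ
  have hconj {M : Matrix (Fin n) (Fin n) ℝ} (hM : M.PosSemidef) :
      ((Φ⁻¹)ᵀ * M * Φ⁻¹).PosSemidef :=
    hM.conjTranspose_mul_mul_same Φ⁻¹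
  obtain ⟨c, hc, hcS⟩ := (hpos hΩhat).isHermitian.exists_pos_smul_one_sub_posSemidef
  obtain ⟨d, hd, hdM⟩ := (hconj hΩhat).isHermitian.exists_pos_smul_one_sub_posSemidef
  refine ⟨min 1 (c⁻¹ * d⁻¹), by positivity, min_le_left _ _, fun Om hOm hle ↦ ⟨hpos hOm, ?_⟩⟩
  set γ := min 1 (c⁻¹ * d⁻¹)
  have hγ0 : 0 ≤ γ := by positivity
  have hγd : 0 ≤ c⁻¹ - γ * d := by
    have h : γ * d ≤ c⁻¹ * d⁻¹ * d := by gcongr; exact min_le_right _ _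
    rw [inv_mul_cancel_right₀ hd.ne'] at h
    linarith
  have hinv : ((Φ * Om * Φᵀ + Q)⁻¹ - c⁻¹ • (1 : Matrix (Fin n) (Fin n) ℝ)).PosSemidef := by
    have hcinv : (c • (1 : Matrix (Fin n) (Fin n) ℝ))⁻¹ = c⁻¹ • 1 :=
      inv_eq_right_inv (by simp [smul_smul, hc.ne'])
    rw [← hcinv]
    refine (hpos hOm).posSemidef_inv_sub_inv (PosDef.one.smul hc) ?_
    convert hcS.add (hle.mul_mul_conjTranspose_same Φ) using 1
    rw [conjTranspose_eq_transpose_of_trivial]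
    noncomm_ring
  convert ((hinv.add (PosSemidef.one.smul hγd)).add (hdM.smul hγ0)).add
    ((hconj hle).smul hγ0) using 1
  rw [Matrix.mul_sub, Matrix.sub_mul]
  module
end

section
/- Let n ≥ 1, let Φ be an invertible n×n real matrix, let Q be an n×n positive semidefinite real matrix, and let P̆ be an n×n positive definite real matrix. Then there exists a real constant γ with 0 < γ ≤ 1 such that for every n×n positive definite real matrix P with P ⪰ P̆, the matrix Φ P Φᵀ + Q is positive definite (hence invertible) and (Φ P Φᵀ + Q)⁻¹ ⪰ γ · Φ⁻ᵀ P⁻¹ Φ⁻¹. -/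
open Matrix

namespace Matrix

variable {m : Type*} [Fintype m] [DecidableEq m]

/-- Inversion is antitone on positive definite matrices in the Loewner order. -/
theorem PosDef.posSemidef_inv_sub_inv_s1 {A B : Matrix m m ℝ} (hA : A.PosDef)
    (hAB : (B - A).PosSemidef) : (A⁻¹ - B⁻¹).PosSemidef := by
  have hB : B.PosDef := by simpa using hA.add_posSemidef hAB
  have : Invertible A⁻¹ := hA.inv.isUnit.invertible
  have : Invertible B := hB.isUnit.invertible
  have hAdet : IsUnit A.det := (isUnit_iff_isUnit_det A).mp hA.isUnit
  have h₂ := (PosDef.fromBlocks₂₂ B 1 hA.inv).mpr (by simpa [nonsing_inv_nonsing_inv A hAdet])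
  simpa using (PosDef.fromBlocks₁₁ 1 A⁻¹ hB).mp h₂

/-- A positive semidefinite matrix is bounded above by a positive multiple of the identity. -/
theorem PosSemidef.exists_smul_one_sub {A : Matrix m m ℝ} (hA : A.PosSemidef) :
    ∃ t : ℝ, 0 < t ∧ (t • (1 : Matrix m m ℝ) - A).PosSemidef := by
  have hnn := hA.eigenvalues_nonneg
  have hsum := Finset.sum_nonneg fun i (_ : i ∈ Finset.univ) => hnn i
  set t : ℝ := 1 + ∑ i, hA.1.eigenvalues i with ht
  refine ⟨t, by positivity, ?_⟩
  have hle (i : m) : hA.1.eigenvalues i ≤ t :=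
    (Finset.single_le_sum (fun j _ => hnn j) (Finset.mem_univ i)).trans (by linarith)
  have hD : (diagonal fun i => t - hA.1.eigenvalues i).PosSemidef :=
    PosSemidef.diagonal fun i => sub_nonneg.mpr (hle i)
  have key : t • (1 : Matrix m m ℝ) - A = Unitary.conjStarAlgAut ℝ _ hA.1.eigenvectorUnitary
      (diagonal fun i => t - hA.1.eigenvalues i) := by
    conv_lhs => rw [hA.1.spectral_theorem]
    rw [← diagonal_sub, map_sub, ← smul_one_eq_diagonal, map_smul, map_one]
    rfl
  rw [key, Unitary.conjStarAlgAut_apply]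
  exact hD.mul_mul_conjTranspose_same _

/-- A positive semidefinite matrix is bounded above by a positive multiple of any given positive
definite matrix. -/
theorem PosSemidef.exists_smul_sub {Q M : Matrix m m ℝ} (hQ : Q.PosSemidef) (hM : M.PosDef) :
    ∃ c : ℝ, 0 < c ∧ (c • M - Q).PosSemidef := by
  obtain ⟨q, hq, hqQ⟩ := hQ.exists_smul_one_sub
  obtain ⟨t, ht, htM⟩ := hM.inv.posSemidef.exists_smul_one_sub
  have hMdet : IsUnit M.det := (isUnit_iff_isUnit_det M).mp hM.isUnit
  have h := hM.inv.posSemidef_inv_sub_inv_s1 htM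
  have hinv : (t • (1 : Matrix m m ℝ))⁻¹ = t⁻¹ • 1 :=
    inv_eq_right_inv (by simp [smul_smul, ht.ne'])
  rw [nonsing_inv_nonsing_inv M hMdet, hinv] at h
  refine ⟨q * t, by positivity, ?_⟩
  have h' := (h.smul (by positivity : 0 ≤ q * t)).add hqQ
  convert! h' using 1
  rw [smul_sub, smul_smul, mul_assoc, mul_inv_cancel₀ ht.ne', mul_one]
  abel

end Matrix

/-- Part (2) of the matrix-inversion lemma (Lemma 1), equation (32): for an invertible `Φ`,
a positive semidefinite `Q` and a positive definite lower bound `Pbreve`, there is a constant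
`0 < γ ≤ 1` such that `(Φ P Φᵀ + Q)⁻¹ ⪰ γ • Φ⁻ᵀ P⁻¹ Φ⁻¹` for every positive definite
`P ⪰ Pbreve`. -/
theorem stmt_1 (n : ℕ) (hn : 1 ≤ n)
    (Φ Q Pbreve : Matrix (Fin n) (Fin n) ℝ)
    (hΦ : IsUnit Φ.det) (hQ : Q.PosSemidef) (hPbreve : Pbreve.PosDef) :
    ∃ γ : ℝ, 0 < γ ∧ γ ≤ 1 ∧
      ∀ P : Matrix (Fin n) (Fin n) ℝ, P.PosDef → (P - Pbreve).PosSemidef →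
        (Φ * P * Φᵀ + Q).PosDef ∧
        ((Φ * P * Φᵀ + Q)⁻¹ - γ • ((Φ⁻¹)ᵀ * P⁻¹ * Φ⁻¹)).PosSemidef := by
  have hΦu : IsUnit Φ := (isUnit_iff_isUnit_det Φ).mpr hΦ
  have hconj (X : Matrix (Fin n) (Fin n) ℝ) (hX : X.PosDef) : (Φ * X * Φᵀ).PosDef := by
    simpa [star_eq_conjTranspose] using (IsUnit.posDef_star_right_conjugate_iff hΦu).mpr hX
  obtain ⟨c, hc, hcQ⟩ := hQ.exists_smul_sub (hconj Pbreve hPbreve)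
  refine ⟨(1 + c)⁻¹, by positivity, inv_le_one_of_one_le₀ (by linarith), fun P hP hPP => ?_⟩
  have hN : (Φ * P * Φᵀ + Q).PosDef := (hconj P hP).add_posSemidef hQ
  refine ⟨hN, ?_⟩
  have hdiff : ((1 + c) • (Φ * P * Φᵀ) - (Φ * P * Φᵀ + Q)).PosSemidef := by
    have h := ((hPP.mul_mul_conjTranspose_same Φ).smul hc.le).add hcQ
    convert! h using 1
    simp only [conjTranspose_eq_transpose_of_trivial, Matrix.mul_sub, Matrix.sub_mul, smul_sub,
      add_smul, one_smul]
    abel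
  have hPdet : IsUnit P.det := (isUnit_iff_isUnit_det P).mp hP.isUnit
  have hinv : ((1 + c) • (Φ * P * Φᵀ))⁻¹ = (1 + c)⁻¹ • ((Φ⁻¹)ᵀ * P⁻¹ * Φ⁻¹) := by
    have hc' : 1 + c ≠ 0 := by positivity
    have : Invertible (1 + c) := invertibleOfNonzero hc'
    rw [inv_smul _ _ ((isUnit_iff_isUnit_det _).mp (hconj P hP).isUnit), invOf_eq_inv,
      Matrix.mul_inv_rev, Matrix.mul_inv_rev, transpose_nonsing_inv, Matrix.mul_assoc]
  rw [← hinv]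
  exact hN.posSemidef_inv_sub_inv_s1 hdiff
end

section
/- Let Ξ be an N×N positive definite real matrix and let e be an N×m real matrix whose columns are linearly independent (full column rank). Then eᵀ Ξ⁻¹ e is positive definite (hence invertible), and setting Γ* := Ξ⁻¹ e (eᵀ Ξ⁻¹ e)⁻¹ one has: (i) eᵀ Γ* = I_m; (ii) Γ*ᵀ Ξ Γ* = (eᵀ Ξ⁻¹ e)⁻¹; and (iii) for every N×m real matrix Γ with eᵀ Γ = I_m, (eᵀ Ξ⁻¹ e)⁻¹ ⪯ Γᵀ Ξ Γ. -/
open Matrix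

/-- If `eᵀ * L = 1 = eᵀ * Γ`, and `Ξ * L = e * P`, then `Γᵀ * Ξ * Γ - P` is the
`Ξ`-square of `Γ - L`. -/
lemma sub_eq_transpose_sub_mul_mul_sub {n k R : Type*} [Fintype n] [Fintype k] [DecidableEq k]
    [CommRing R] {Ξ : Matrix n n R} (hΞ : Ξ.IsSymm) {e L Γ : Matrix n k R} {P : Matrix k k R}
    (hP : P.IsSymm) (hL : eᵀ * L = 1) (hΓ : eᵀ * Γ = 1) (hΞL : Ξ * L = e * P) :
    Γᵀ * Ξ * Γ - P = (Γ - L)ᵀ * Ξ * (Γ - L) := by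
  have hLΞ : Lᵀ * Ξ = P * eᵀ := by
    simpa [transpose_mul, hΞ.eq, hP.eq] using congrArg transpose hΞL
  have hΓe : Γᵀ * e = 1 := by
    simpa [transpose_mul] using congrArg transpose hΓ
  have hΓΞL : Γᵀ * Ξ * L = P := by
    rw [Matrix.mul_assoc, hΞL, ← Matrix.mul_assoc, hΓe, Matrix.one_mul]
  have hLΞΓ : Lᵀ * Ξ * Γ = P := by
    rw [hLΞ, Matrix.mul_assoc, hΓ, Matrix.mul_one]
  have hLΞL : Lᵀ * Ξ * L = P := by
    rw [hLΞ, Matrix.mul_assoc, hL, Matrix.mul_one]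
  rw [transpose_sub, Matrix.sub_mul, Matrix.sub_mul, Matrix.mul_sub, Matrix.mul_sub,
    hΓΞL, hLΞΓ, hLΞL]
  abel

/-- Optimality of the matrix fusion weight `Γ* = Ξ⁻¹ e (eᵀ Ξ⁻¹ e)⁻¹` (equations (12), (29)):
for positive definite `Ξ` and full-column-rank `e`, the matrix `eᵀ Ξ⁻¹ e` is positive
definite, `Γ*` satisfies the unbiasedness constraint `eᵀ Γ* = I`, its fused covariance is
`Γ*ᵀ Ξ Γ* = (eᵀ Ξ⁻¹ e)⁻¹`, and `(eᵀ Ξ⁻¹ e)⁻¹ ⪯ Γᵀ Ξ Γ` for every `Γ` with `eᵀ Γ = I`. -/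
theorem stmt_6 (N m : ℕ)
    (Ξ : Matrix (Fin N) (Fin N) ℝ) (hΞ : Ξ.PosDef)
    (e : Matrix (Fin N) (Fin m) ℝ)
    (he : LinearIndependent ℝ (fun j : Fin m => eᵀ j)) :
    (eᵀ * Ξ⁻¹ * e).PosDef ∧
      eᵀ * (Ξ⁻¹ * e * (eᵀ * Ξ⁻¹ * e)⁻¹) = (1 : Matrix (Fin m) (Fin m) ℝ) ∧
      (Ξ⁻¹ * e * (eᵀ * Ξ⁻¹ * e)⁻¹)ᵀ * Ξ * (Ξ⁻¹ * e * (eᵀ * Ξ⁻¹ * e)⁻¹) =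
        (eᵀ * Ξ⁻¹ * e)⁻¹ ∧
      ∀ Γ : Matrix (Fin N) (Fin m) ℝ, eᵀ * Γ = (1 : Matrix (Fin m) (Fin m) ℝ) →
        (Γᵀ * Ξ * Γ - (eᵀ * Ξ⁻¹ * e)⁻¹).PosSemidef := by
  have hA : (eᵀ * Ξ⁻¹ * e).PosDef := by
    rw [← conjTranspose_eq_transpose_of_trivial]
    exact hΞ.inv.conjTranspose_mul_mul_same (mulVec_injective_iff.mpr he)
  have hΞs : Ξ.IsSymm := by
    simpa [IsSymm, IsHermitian, conjTranspose_eq_transpose_of_trivial] using hΞ.isHermitian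
  have hPs : (eᵀ * Ξ⁻¹ * e)⁻¹.IsSymm := by
    simpa [IsSymm, IsHermitian, conjTranspose_eq_transpose_of_trivial] using hA.inv.isHermitian
  have hL : eᵀ * (Ξ⁻¹ * e * (eᵀ * Ξ⁻¹ * e)⁻¹) = 1 := by
    rw [← Matrix.mul_assoc, ← Matrix.mul_assoc,
      mul_nonsing_inv _ ((isUnit_iff_isUnit_det _).mp hA.isUnit)]
  have hΞL : Ξ * (Ξ⁻¹ * e * (eᵀ * Ξ⁻¹ * e)⁻¹) = e * (eᵀ * Ξ⁻¹ * e)⁻¹ := by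
    rw [Matrix.mul_assoc Ξ⁻¹,
      mul_nonsing_inv_cancel_left _ _ ((isUnit_iff_isUnit_det _).mp hΞ.isUnit)]
  refine ⟨hA, hL, ?_, fun Γ hΓ => ?_⟩
  · rw [← sub_eq_zero, sub_eq_transpose_sub_mul_mul_sub hΞs hPs hL hL hΞL, sub_self,
      Matrix.mul_zero]
  · rw [sub_eq_transpose_sub_mul_mul_sub hΞs hPs hL hΓ hΞL,
      ← conjTranspose_eq_transpose_of_trivial]
    exact hΞ.posSemidef.conjTranspose_mul_mul_same _
end

section
/- Let ι and κ be finite nonempty index types, let Ξ be a positive definite real matrix indexed by ι × κ (rows and columns indexed by pairs (i, a) with i ∈ ι, a ∈ κ), and let e be the (ι × κ)-by-κ real matrix with entries e (i, a) b = 1 if a = b and 0 otherwise (a stack of identity blocks). Then eᵀ Ξ⁻¹ e is positive definite, and for every i ∈ ι, (eᵀ Ξ⁻¹ e)⁻¹ ⪯ Pⁱⁱ, where Pⁱⁱ is the κ×κ matrix with entries Pⁱⁱ a b = Ξ (i, a) (i, b) (the i-th diagonal block of Ξ). -/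
open Matrix

/-- A congruence transform of a positive definite matrix by a matrix with a left inverse is
positive definite. -/
theorem Matrix.PosDef.transpose_mul_mul_same_of_leftInverse {m n : Type*} [Fintype m] [Fintype n]
    [DecidableEq n] {A : Matrix m m ℝ} (hA : A.PosDef) {B : Matrix m n ℝ} {L : Matrix n m ℝ}
    (hL : L * B = 1) : (Bᵀ * A * B).PosDef := by
  have hB : Function.Injective B.mulVec := fun x y hxy => by
    simpa [hL] using congrArg L.mulVec hxy
  simpa using hA.conjTranspose_mul_mul_same hB

/-- **Gauss–Markov**: the covariance `(Bᵀ A⁻¹ B)⁻¹` of the generalized least squares estimator is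
dominated by the covariance `L A Lᵀ` of any linear unbiased estimator `L`. -/
theorem Matrix.PosDef.posSemidef_mul_mul_transpose_sub_inv {m n : Type*} [Fintype m] [Fintype n]
    [DecidableEq m] [DecidableEq n] {A : Matrix m m ℝ} (hA : A.PosDef) {B : Matrix m n ℝ}
    {L : Matrix n m ℝ} (hL : L * B = 1) :
    (L * A * Lᵀ - (Bᵀ * A⁻¹ * B)⁻¹).PosSemidef := by
  have hM := hA.inv.transpose_mul_mul_same_of_leftInverse hL
  set M := Bᵀ * A⁻¹ * B with hMdef
  have hMu : IsUnit M.det := (isUnit_iff_isUnit_det M).mp hM.isUnit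
  have hAu : IsUnit A.det := (isUnit_iff_isUnit_det A).mp hA.isUnit
  have hAt : A⁻¹ᵀ = A⁻¹ := by simpa using hA.inv.isHermitian.eq
  have hMt : M⁻¹ᵀ = M⁻¹ := by simpa using hM.inv.isHermitian.eq
  have hLt : Bᵀ * Lᵀ = 1 := by rw [← transpose_mul, hL, transpose_one]
  have key : (L - M⁻¹ * Bᵀ * A⁻¹) * A * (L - M⁻¹ * Bᵀ * A⁻¹)ᵀ = L * A * Lᵀ - M⁻¹ := by
    have h₁ : (L - M⁻¹ * Bᵀ * A⁻¹) * A = L * A - M⁻¹ * Bᵀ := by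
      rw [Matrix.sub_mul, nonsing_inv_mul_cancel_right _ _ hAu]
    have h₂ : (L - M⁻¹ * Bᵀ * A⁻¹)ᵀ = Lᵀ - A⁻¹ * B * M⁻¹ := by
      simp only [transpose_sub, transpose_mul, transpose_transpose, hAt, hMt, Matrix.mul_assoc]
    have h₃ : L * A * (A⁻¹ * B * M⁻¹) = M⁻¹ := by
      rw [← Matrix.mul_assoc, ← Matrix.mul_assoc, mul_nonsing_inv_cancel_right _ _ hAu, hL,
        Matrix.one_mul]
    have h₄ : M⁻¹ * Bᵀ * (A⁻¹ * B * M⁻¹) = M⁻¹ := by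
      calc M⁻¹ * Bᵀ * (A⁻¹ * B * M⁻¹) = M⁻¹ * M * M⁻¹ := by
            simp only [hMdef, Matrix.mul_assoc]
        _ = M⁻¹ := by rw [nonsing_inv_mul _ hMu, Matrix.one_mul]
    rw [h₁, h₂, Matrix.mul_sub, Matrix.sub_mul, Matrix.sub_mul, h₃, h₄, Matrix.mul_assoc M⁻¹, hLt,
      Matrix.mul_one, sub_self, sub_zero]
  rw [← key]
  simpa using hA.posSemidef.mul_mul_conjTranspose_same (L - M⁻¹ * Bᵀ * A⁻¹)

/-- The optimal matrix-weighted fusion is no worse than any local estimate (`P^f ⪯ Pⁱ`):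
for a positive definite joint covariance `Ξ` indexed by `ι × κ` and the stacked-identity
matrix `e`, the fused covariance `(eᵀ Ξ⁻¹ e)⁻¹` is dominated (in the Loewner order) by
every diagonal block `Pⁱⁱ` of `Ξ`. -/
theorem stmt_7 (ι κ : Type*) [Fintype ι] [Fintype κ] [Nonempty ι] [Nonempty κ]
    [DecidableEq ι] [DecidableEq κ]
    (Ξ : Matrix (ι × κ) (ι × κ) ℝ) (hΞ : Ξ.PosDef)
    (e : Matrix (ι × κ) κ ℝ) (he : ∀ (p : ι × κ) (b : κ), e p b = if p.2 = b then 1 else 0) :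
    (eᵀ * Ξ⁻¹ * e).PosDef ∧
      ∀ i : ι, (Matrix.of (fun a b : κ => Ξ (i, a) (i, b)) - (eᵀ * Ξ⁻¹ * e)⁻¹).PosSemidef := by
  have hL (i : ι) : (1 : Matrix (ι × κ) (ι × κ) ℝ).submatrix (Prod.mk i) id * e = 1 := by
    ext a b
    simp only [Matrix.mul_apply, submatrix_apply, Matrix.one_apply, id, ite_mul, one_mul, zero_mul,
      Finset.sum_ite_eq, Finset.mem_univ, if_true, he]
  refine ⟨hΞ.inv.transpose_mul_mul_same_of_leftInverse (hL (Classical.arbitrary ι)), fun i => ?_⟩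
  convert hΞ.posSemidef_mul_mul_transpose_sub_inv (hL i) using 2
  ext a b
  simp [Matrix.mul_apply, Matrix.one_apply]
end

section
/- Let n ≥ 1, let γ be a real number with γ > 0, and let k, m be natural numbers. For each j with k ≤ j < k + m let A_j be an invertible n×n real matrix and B_j a symmetric positive semidefinite n×n real matrix, and for k ≤ j ≤ k + m let X_j be a symmetric positive semidefinite n×n real matrix. Define the transition products O_{l,k} by O_{k,k} = I and O_{l+1,k} = A_l O_{l,k}. If X_{j+1} ⪰ γ · A_j⁻ᵀ X_j A_j⁻¹ + B_j for every j with k ≤ j < k + m, and γ ≤ 1, then X_{k+m} ⪰ γᵐ · O_{k+m,k}⁻ᵀ X_k O_{k+m,k}⁻¹ + Σ_{j=k}^{k+m−1} γ^{k+m−1−j} · O_{k+m,j+1}⁻ᵀ B_j O_{k+m,j+1}⁻¹. -/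
open Matrix Finset

/-- The telescoped information inequality (equations (33)–(35)): iterating the one-step
inequality `X (j+1) ⪰ γ • A_j⁻ᵀ X_j A_j⁻¹ + B_j` over `m` steps along the transition
products `O` yields
`X (k+m) ⪰ γ^m • O_{k+m,k}⁻ᵀ X_k O_{k+m,k}⁻¹ + ∑_{j=k}^{k+m-1} γ^{k+m-1-j} • O_{k+m,j+1}⁻ᵀ B_j O_{k+m,j+1}⁻¹`. -/
theorem stmt_8 (n : ℕ) (hn : 1 ≤ n) (γ : ℝ) (hγ0 : 0 < γ) (hγ1 : γ ≤ 1) (k m : ℕ)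
    (A B X : ℕ → Matrix (Fin n) (Fin n) ℝ)
    (O : ℕ → ℕ → Matrix (Fin n) (Fin n) ℝ)
    (hA : ∀ j, k ≤ j → j < k + m → IsUnit (A j).det)
    (hB : ∀ j, k ≤ j → j < k + m → (B j).PosSemidef)
    (hX : ∀ j, k ≤ j → j ≤ k + m → (X j).PosSemidef)
    (hO0 : ∀ j, O j j = 1)
    (hOs : ∀ l j, O (l + 1) j = A l * O l j)
    (hrec : ∀ j, k ≤ j → j < k + m →
      (X (j + 1) - (γ • (((A j)⁻¹)ᵀ * X j * (A j)⁻¹) + B j)).PosSemidef) :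
    (X (k + m) -
      (γ ^ m • (((O (k + m) k)⁻¹)ᵀ * X k * (O (k + m) k)⁻¹) +
        ∑ j ∈ Finset.Ico k (k + m),
          γ ^ (k + m - 1 - j) • (((O (k + m) (j + 1))⁻¹)ᵀ * B j * (O (k + m) (j + 1))⁻¹))).PosSemidef := by
  induction m with
  | zero => simpa [hO0] using PosSemidef.zero
  | succ m ih =>
    have prev := ih (fun j h₁ h₂ => hA j h₁ (by omega)) (fun j h₁ h₂ => hB j h₁ (by omega))
      (fun j h₁ h₂ => hX j h₁ (by omega)) (fun j h₁ h₂ => hrec j h₁ (by omega))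
    have step := hrec (k + m) (by omega) (by omega)
    have conj := (prev.conjTranspose_mul_mul_same ((A (k + m))⁻¹)).smul hγ0.le
    rw [conjTranspose_eq_transpose_of_trivial] at conj
    convert step.add conj using 1
    have hsum : ∑ j ∈ Finset.Ico k (k + m), γ ^ (k + (m + 1) - 1 - j) •
          (((O (k + m + 1) (j + 1))⁻¹)ᵀ * B j * (O (k + m + 1) (j + 1))⁻¹) =
        γ • (((A (k + m))⁻¹)ᵀ * (∑ j ∈ Finset.Ico k (k + m), γ ^ (k + m - 1 - j) •
          (((O (k + m) (j + 1))⁻¹)ᵀ * B j * (O (k + m) (j + 1))⁻¹)) * (A (k + m))⁻¹) := by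
      rw [Matrix.mul_sum, Matrix.sum_mul, Finset.smul_sum]
      refine Finset.sum_congr rfl fun j hj => ?_
      have hexp : k + (m + 1) - 1 - j = (k + m - 1 - j) + 1 := by
        have := Finset.mem_Ico.mp hj
        omega
      rw [hOs, Matrix.mul_inv_rev, transpose_mul, hexp, pow_succ', mul_smul]
      simp only [Matrix.mul_smul, Matrix.smul_mul, Matrix.mul_assoc]
    have hlast : k + (m + 1) - 1 - (k + m) = 0 := by omega
    rw [← Nat.add_assoc k m 1, Finset.sum_Ico_succ_top (by omega), Nat.add_assoc k m 1, hlast]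
    rw [← Nat.add_assoc k m 1] at hsum ⊢
    rw [hsum, hO0, hOs, Matrix.mul_inv_rev, transpose_mul, pow_succ', mul_smul]
    simp only [Matrix.mul_sub, Matrix.sub_mul, Matrix.mul_add, Matrix.add_mul, smul_sub, smul_add,
      Matrix.mul_smul, Matrix.smul_mul, Matrix.mul_assoc, pow_zero, one_smul, inv_one,
      transpose_one, Matrix.one_mul, Matrix.mul_one]
    abel
end

section
/- Let n ≥ 1, let γ, η, α be real numbers with 0 < γ ≤ 1, η > 0 and α > 0, and let N ≥ 1 be a natural number. For each j ∈ ℕ let A_j be an invertible n×n real matrix with A_j⁻ᵀ A_j⁻¹ ⪰ η² · I, let B_j be a symmetric positive semidefinite n×n real matrix, and let X_j be a symmetric positive semidefinite n×n real matrix such that X_{j+1} ⪰ γ · A_j⁻ᵀ X_j A_j⁻¹ + B_j for every j. Define O_{l,k} by O_{k,k} = I and O_{l+1,k} = A_l O_{l,k}, and assume uniform observability: for every k ∈ ℕ, Σ_{j=k}^{k+N−1} O_{j+1,k}ᵀ B_j O_{j+1,k} ⪰ α · I. Then for every m ≥ N, X_m ⪰ γᴺ · α · η^{2N} · I; in particular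 there exists ϑ > 0 with X_m ⪰ ϑ · I for all m ≥ N. -/
open Matrix Finset

/-- The Loewner order implies the order of the quadratic forms. -/
theorem dotProduct_mulVec_le_of_posSemidef_sub {n : ℕ} {M P : Matrix (Fin n) (Fin n) ℝ}
    (h : (M - P).PosSemidef) (x : Fin n → ℝ) : x ⬝ᵥ P *ᵥ x ≤ x ⬝ᵥ M *ᵥ x := by
  have := h.dotProduct_mulVec_nonneg x
  rw [star_trivial, sub_mulVec, dotProduct_sub] at this
  linarith

/-- The quadratic form of a congruence `Cᵀ M C`. -/
theorem dotProduct_transpose_mul_mul_mulVec {n : ℕ} (C M : Matrix (Fin n) (Fin n) ℝ)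
    (x : Fin n → ℝ) : x ⬝ᵥ (Cᵀ * M * C) *ᵥ x = (C *ᵥ x) ⬝ᵥ M *ᵥ (C *ᵥ x) := by
  rw [← mulVec_mulVec, ← mulVec_mulVec, dotProduct_mulVec, vecMul_transpose]

/-- A product of `i` matrices with `A⁻ᵀ A⁻¹ ⪰ η² I` expands squared lengths by at most
`η^(-2 i)`. -/
theorem pow_mul_dotProduct_transition_le {n : ℕ} {η : ℝ}
    {A : ℕ → Matrix (Fin n) (Fin n) ℝ} (hA : ∀ j, IsUnit (A j).det)
    (hAbound : ∀ j,
      (((A j)⁻¹)ᵀ * (A j)⁻¹ - η ^ 2 • (1 : Matrix (Fin n) (Fin n) ℝ)).PosSemidef)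
    {x : ℕ → Fin n → ℝ} {k : ℕ} (hx : ∀ i, x (i + 1) = A (k + i) *ᵥ x i) (i : ℕ) :
    η ^ (2 * i) * (x i ⬝ᵥ x i) ≤ x 0 ⬝ᵥ x 0 := by
  induction i with
  | zero => simp
  | succ i ih =>
    have hinv : (A (k + i))⁻¹ *ᵥ x (i + 1) = x i := by
      rw [hx, mulVec_mulVec, nonsing_inv_mul _ (hA _), one_mulVec]
    have h := dotProduct_mulVec_le_of_posSemidef_sub (hAbound (k + i)) (x (i + 1))
    have hc := dotProduct_transpose_mul_mul_mulVec (A (k + i))⁻¹ 1 (x (i + 1))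
    rw [mul_one, hinv, one_mulVec] at hc
    rw [hc, smul_mulVec, one_mulVec, dotProduct_smul, smul_eq_mul] at h
    have hp : 0 ≤ η ^ (2 * i) := by rw [pow_mul]; positivity
    calc η ^ (2 * (i + 1)) * (x (i + 1) ⬝ᵥ x (i + 1))
        = η ^ (2 * i) * (η ^ 2 * (x (i + 1) ⬝ᵥ x (i + 1))) := by ring
      _ ≤ η ^ (2 * i) * (x i ⬝ᵥ x i) := by gcongr
      _ ≤ _ := ih

/-- Along a trajectory of the system, the information collected so far, discounted by `γ^i`,
bounds the quadratic form of `X` from below. -/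
theorem pow_mul_sum_le_dotProduct_mulVec {n : ℕ} {γ : ℝ} (hγ0 : 0 ≤ γ) (hγ1 : γ ≤ 1)
    {A B X : ℕ → Matrix (Fin n) (Fin n) ℝ} (hA : ∀ j, IsUnit (A j).det)
    (hB : ∀ j, (B j).PosSemidef) {k : ℕ} (hX : (X k).PosSemidef)
    (hrec : ∀ j, (X (j + 1) - (γ • (((A j)⁻¹)ᵀ * X j * (A j)⁻¹) + B j)).PosSemidef)
    {x : ℕ → Fin n → ℝ} (hx : ∀ i, x (i + 1) = A (k + i) *ᵥ x i) (i : ℕ) :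
    γ ^ i * ∑ j ∈ Finset.range i, x (j + 1) ⬝ᵥ B (k + j) *ᵥ x (j + 1) ≤
      x i ⬝ᵥ X (k + i) *ᵥ x i := by
  induction i with
  | zero => simpa using hX.dotProduct_mulVec_nonneg (x 0)
  | succ i ih =>
    have hinv : (A (k + i))⁻¹ *ᵥ x (i + 1) = x i := by
      rw [hx, mulVec_mulVec, nonsing_inv_mul _ (hA _), one_mulVec]
    have h := dotProduct_mulVec_le_of_posSemidef_sub (hrec (k + i)) (x (i + 1))
    rw [add_mulVec, dotProduct_add, smul_mulVec, dotProduct_smul, smul_eq_mul,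
      dotProduct_transpose_mul_mul_mulVec, hinv] at h
    have hb : 0 ≤ x (i + 1) ⬝ᵥ B (k + i) *ᵥ x (i + 1) := by
      simpa using (hB (k + i)).dotProduct_mulVec_nonneg (x (i + 1))
    have hγ : γ ^ (i + 1) ≤ 1 := pow_le_one₀ hγ0 hγ1
    rw [Finset.sum_range_succ, mul_add, pow_succ', mul_assoc, ← pow_succ']
    have h1 := mul_le_mul_of_nonneg_left ih hγ0
    have h2 := mul_le_mul_of_nonneg_right hγ hb
    rw [← add_assoc]
    linarith

/-- Abstract form of Theorem 3 (boundedness of error covariances): under the one-step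
information inequality `X (j+1) ⪰ γ • A_j⁻ᵀ X_j A_j⁻¹ + B_j`, the singular-value bound
`A_j⁻ᵀ A_j⁻¹ ⪰ η² • I` and the uniform observability bound
`∑_{j=k}^{k+N-1} O_{j+1,k}ᵀ B_j O_{j+1,k} ⪰ α • I`, one has
`X m ⪰ γ^N α η^(2N) • I` for every `m ≥ N`; in particular `X m ⪰ ϑ • I` for some `ϑ > 0`. -/
theorem stmt_10 (n : ℕ) (hn : 1 ≤ n) (γ η α : ℝ)
    (hγ0 : 0 < γ) (hγ1 : γ ≤ 1) (hη : 0 < η) (hα : 0 < α)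
    (N : ℕ) (hN : 1 ≤ N)
    (A B X : ℕ → Matrix (Fin n) (Fin n) ℝ)
    (O : ℕ → ℕ → Matrix (Fin n) (Fin n) ℝ)
    (hA : ∀ j, IsUnit (A j).det)
    (hAbound : ∀ j,
      (((A j)⁻¹)ᵀ * (A j)⁻¹ - η ^ 2 • (1 : Matrix (Fin n) (Fin n) ℝ)).PosSemidef)
    (hB : ∀ j, (B j).PosSemidef)
    (hX : ∀ j, (X j).PosSemidef)
    (hrec : ∀ j, (X (j + 1) - (γ • (((A j)⁻¹)ᵀ * X j * (A j)⁻¹) + B j)).PosSemidef)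
    (hO0 : ∀ k, O k k = 1)
    (hOs : ∀ l k, O (l + 1) k = A l * O l k)
    (hobs : ∀ k, ((∑ j ∈ Finset.Ico k (k + N), (O (j + 1) k)ᵀ * B j * O (j + 1) k) -
      α • (1 : Matrix (Fin n) (Fin n) ℝ)).PosSemidef) :
    (∀ m, N ≤ m →
      (X m - (γ ^ N * α * η ^ (2 * N)) • (1 : Matrix (Fin n) (Fin n) ℝ)).PosSemidef) ∧
    ∃ ϑ : ℝ, 0 < ϑ ∧ ∀ m, N ≤ m →
      (X m - ϑ • (1 : Matrix (Fin n) (Fin n) ℝ)).PosSemidef := by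
  have main : ∀ m, N ≤ m →
      (X m - (γ ^ N * α * η ^ (2 * N)) • (1 : Matrix (Fin n) (Fin n) ℝ)).PosSemidef := by
    intro m hm
    obtain ⟨k, rfl⟩ := Nat.exists_eq_add_of_le' hm
    refine PosSemidef.of_dotProduct_mulVec_nonneg
      ((hX _).isHermitian.sub (isHermitian_one.smul (IsSelfAdjoint.all _))) fun y => ?_
    have hOdet : ∀ i, IsUnit (O (k + i) k).det := by
      intro i
      induction i with
      | zero => simp [hO0]
      | succ i ih =>
        rw [← add_assoc, hOs, det_mul]
        exact (hA _).mul ih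
    set x : ℕ → Fin n → ℝ := fun i => O (k + i) k *ᵥ ((O (k + N) k)⁻¹ *ᵥ y) with hxdef
    have hx : ∀ i, x (i + 1) = A (k + i) *ᵥ x i := by
      intro i
      simp only [hxdef]
      rw [← add_assoc, hOs, mulVec_mulVec (M := A (k + i))]
    have hx0 : x 0 = (O (k + N) k)⁻¹ *ᵥ y := by simp [hxdef, hO0]
    have hxN : x N = y := by
      simp only [hxdef]
      rw [mulVec_mulVec, mul_nonsing_inv _ (hOdet N), one_mulVec]
    have hlen := pow_mul_dotProduct_transition_le hA hAbound hx N
    have hinfo := pow_mul_sum_le_dotProduct_mulVec hγ0.le hγ1 hA hB (hX k) hrec hx N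
    have hgram := dotProduct_mulVec_le_of_posSemidef_sub (hobs k) (x 0)
    rw [smul_mulVec, one_mulVec, dotProduct_smul, smul_eq_mul, sum_mulVec, dotProduct_sum,
      Finset.sum_Ico_eq_sum_range, add_tsub_cancel_left] at hgram
    simp only [dotProduct_transpose_mul_mul_mulVec] at hgram
    rw [hx0] at hgram
    change _ ≤ ∑ j ∈ Finset.range N, x (j + 1) ⬝ᵥ B (k + j) *ᵥ x (j + 1) at hgram
    rw [← hx0] at hgram
    rw [hxN] at hlen hinfo
    rw [star_trivial, sub_mulVec, dotProduct_sub, smul_mulVec, one_mulVec, dotProduct_smul,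
      smul_eq_mul, sub_nonneg]
    calc γ ^ N * α * η ^ (2 * N) * (y ⬝ᵥ y)
        = γ ^ N * (α * (η ^ (2 * N) * (y ⬝ᵥ y))) := by ring
      _ ≤ γ ^ N * (α * (x 0 ⬝ᵥ x 0)) := by gcongr
      _ ≤ γ ^ N * ∑ j ∈ Finset.range N, x (j + 1) ⬝ᵥ B (k + j) *ᵥ x (j + 1) := by gcongr
      _ ≤ _ := hinfo
  exact ⟨main, _, by positivity, main⟩
end

section
/- Let G be a finite tree (a finite connected acyclic simple graph) on vertex set V, let M be an additive commutative group, and let v : V → M. Define messages ψ_t(i→j) ∈ M for ordered pairs of adjacent vertices i, j by the recursion ψ_0(i→j) = v(i) and ψ_{t+1}(i→j) = v(i) + Σ_{l ∈ N(i)} ψ_t(l→i) − ψ_t(j→i), where N(i) is the set of neighbors of i in G. Then for every natural number t with t ≥ diam(G) and every vertex i ∈ V, v(i) + Σ_{l ∈ N(i)} ψ_t(l→i) = Σ_{j ∈ V} v(j). -/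
/-- In a tree, each vertex `i` other than `k` has a unique neighbor one step closer to `k`. -/
theorem SimpleGraph.IsTree.existsUnique_adj_dist_eq_add_one {V : Type*} {G : SimpleGraph V}
    (hG : G.IsTree) {k i : V} (hki : k ≠ i) :
    ∃! l, G.Adj i l ∧ G.dist k i = G.dist k l + 1 := by
  obtain ⟨p, hp⟩ := hG.connected.exists_walk_length_eq_dist i k
  cases p with
  | nil => exact absurd rfl hki
  | @cons _ l _ h q =>
    refine ⟨l, ⟨h, ?_⟩, ?_⟩
    · have h₁ : G.dist l k ≤ q.length := SimpleGraph.dist_le q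
      have h₂ := hG.dist_eq_dist_add_one_of_adj k h
      simp only [SimpleGraph.Walk.length_cons] at hp
      rw [G.dist_comm (u := l)] at h₁
      rw [G.dist_comm (u := i)] at hp
      omega
    · rintro m ⟨hm, hdist⟩
      obtain ⟨r, hr⟩ := hG.connected.exists_walk_length_eq_dist m k
      have hr' : (SimpleGraph.Walk.cons hm r).length = G.dist i k := by
        rw [SimpleGraph.Walk.length_cons, hr, G.dist_comm, ← hdist, G.dist_comm]
      have heq := (hG.existsUnique_path i k).unique
        (SimpleGraph.Walk.isPath_of_length_eq_dist _ hr')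
        (SimpleGraph.Walk.isPath_of_length_eq_dist _ hp)
      simpa using congrArg SimpleGraph.Walk.snd heq

open Finset in
/-- Summing over the neighbors `l` of `i` the values within distance `t` of `l` on the far side
of the edge `l i`, together with the value at `i`, gives the sum over a ball at `i`. -/
theorem SimpleGraph.IsTree.add_sum_neighborFinset_sum_ite {V M : Type*} [Fintype V]
    [AddCommMonoid M] {G : SimpleGraph V} [DecidableRel G.Adj] (hG : G.IsTree) (v : V → M)
    (t : ℕ) (i : V) :
    v i + ∑ l ∈ G.neighborFinset i,
        ∑ k, (if G.dist k i = G.dist k l + 1 ∧ G.dist k l ≤ t then v k else 0) =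
      ∑ k, if G.dist k i ≤ t + 1 then v k else 0 := by
  classical
  have hsingle : v i = ∑ k, if k = i then v k else 0 := by simp
  rw [sum_comm, hsingle, ← sum_add_distrib]
  refine sum_congr rfl fun k _ => ?_
  by_cases hki : k = i
  · subst hki
    simp
  · obtain ⟨l, ⟨hl, hdist⟩, huniq⟩ := hG.existsUnique_adj_dist_eq_add_one hki
    rw [if_neg hki, zero_add, sum_eq_single l]
    · simp [hdist]
    · intro m hm hne
      rw [if_neg]
      exact fun h => hne (huniq m ⟨by simpa using hm, h.1⟩)
    · intro h
      exact absurd (by simpa using hl) h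

/-- The message sent from `i` to `j` after `t` steps is the sum of the values on the side of `i`
of the edge `i j`, within distance `t` of `i`. -/
theorem SimpleGraph.IsTree.message_eq_sum_ite {V M : Type*} [Fintype V] [AddCommGroup M]
    {G : SimpleGraph V} [DecidableRel G.Adj] (hG : G.IsTree) (v : V → M) (ψ : ℕ → V → V → M)
    (hψ0 : ∀ i j : V, G.Adj i j → ψ 0 i j = v i)
    (hψs : ∀ (t : ℕ) (i j : V), G.Adj i j →
      ψ (t + 1) i j = v i + ∑ l ∈ G.neighborFinset i, ψ t l i - ψ t j i)
    (t : ℕ) {i j : V} (hij : G.Adj i j) :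
    ψ t i j = ∑ k, if G.dist k j = G.dist k i + 1 ∧ G.dist k i ≤ t then v k else 0 := by
  induction t generalizing i j with
  | zero =>
    rw [hψ0 i j hij, Finset.sum_eq_single i]
    · simp [SimpleGraph.dist_eq_one_iff_adj, hij]
    · intro k _ hki
      rw [if_neg]
      rintro ⟨-, h⟩
      exact hki (hG.connected.dist_eq_zero_iff.mp (Nat.le_zero.mp h))
    · simp
  | succ t ih =>
    rw [hψs t i j hij, ih hij.symm, Finset.sum_congr rfl fun l hl =>
      ih ((G.mem_neighborFinset i l).mp hl).symm, hG.add_sum_neighborFinset_sum_ite v t i,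
      ← Finset.sum_sub_distrib]
    refine Finset.sum_congr rfl fun k _ => ?_
    have := hG.dist_eq_dist_add_one_of_adj k hij
    split_ifs <;> first | omega | simp


/-- Finite-time consensus on a tree (core of Theorems 1 and 2): under the echo-cancelling
message-passing recursion `ψ 0 i j = v i`,
`ψ (t+1) i j = v i + ∑_{l ∈ N(i)} ψ t l i − ψ t j i` on a finite tree `G`, after at least
`diam G` iterations every vertex holds the global sum: for `t ≥ diam G` and every `i`,
`v i + ∑_{l ∈ N(i)} ψ t l i = ∑_j v j`. -/
theorem stmt_13 (V : Type*) [Fintype V] (G : SimpleGraph V) [DecidableRel G.Adj]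
    (hG : G.IsTree) (M : Type*) [AddCommGroup M] (v : V → M)
    (ψ : ℕ → V → V → M)
    (hψ0 : ∀ i j : V, G.Adj i j → ψ 0 i j = v i)
    (hψs : ∀ (t : ℕ) (i j : V), G.Adj i j →
      ψ (t + 1) i j = v i + ∑ l ∈ G.neighborFinset i, ψ t l i - ψ t j i) :
    ∀ t : ℕ, G.diam ≤ t → ∀ i : V,
      v i + ∑ l ∈ G.neighborFinset i, ψ t l i = ∑ j : V, v j := by
  intro t ht i
  rw [Finset.sum_congr rfl fun l hl => hG.message_eq_sum_ite v ψ hψ0 hψs t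
    ((G.mem_neighborFinset i l).mp hl).symm, hG.add_sum_neighborFinset_sum_ite v t i]
  refine Finset.sum_congr rfl fun k _ => if_pos ?_
  have := hG.connected.nonempty
  have hdist : G.dist k i ≤ G.diam :=
    SimpleGraph.dist_le_diam (SimpleGraph.connected_iff_ediam_ne_top.mp hG.connected)
  omega
end

section
/- Let G be a finite tree (a finite connected acyclic simple graph) on vertex set V, let M be an additive commutative group, and let v : V → M. Define messages ψ_t(i→j) ∈ M for ordered pairs of adjacent vertices i, j by the recursion ψ_0(i→j) = v(i) and ψ_{t+1}(i→j) = v(i) + Σ_{l ∈ N(i)} ψ_t(l→i) − ψ_t(j→i), where N(i) is the set of neighbors of i in G. Then for every natural number t and every ordered pair of adjacent vertices i, j: ψ_t(i→j) = Σ v(u), the sum ranging over all vertices u that lie in the connected component of i in the graph obtained from G by deleting the edge {i, j} and satisfy dist_G(i, u) ≤ t, where dist_G is the graph distance in G. -/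
open Classical

namespace SimpleGraph

variable {V : Type*} {G : SimpleGraph V}

lemma Connected.reachable_deleteEdges_of_dist_lt (hG : G.Connected) {i j u : V}
    (h : G.dist i u < G.dist j u) : (G.deleteEdges {s(i, j)}).Reachable i u := by
  obtain ⟨p, hp⟩ := hG.exists_walk_length_eq_dist i u
  refine ⟨p.toDeleteEdge s(i, j) fun he => ?_⟩
  have hj : j ∈ p.support := p.snd_mem_support_of_mem_edges he
  have h1 := dist_le (p.dropUntil j hj)
  have h2 := p.length_dropUntil_le_length hj
  omega

lemma IsTree.reachable_deleteEdges_iff_dist_lt (hG : G.IsTree) {i j : V} (hij : G.Adj i j)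
    (u : V) : (G.deleteEdges {s(i, j)}).Reachable i u ↔ G.dist i u < G.dist j u := by
  refine ⟨fun hr => ?_, hG.connected.reachable_deleteEdges_of_dist_lt⟩
  by_contra hlt
  have hne : G.dist i u ≠ G.dist j u := by
    simpa only [dist_comm] using hG.dist_ne_of_adj u hij
  have hr' := hG.connected.reachable_deleteEdges_of_dist_lt
    (show G.dist j u < G.dist i u by omega)
  rw [Sym2.eq_swap] at hr'
  exact isBridge_iff.mp (isAcyclic_iff_forall_adj_isBridge.mp hG.isAcyclic hij)
    (hr.trans hr'.symm)

lemma IsTree.existsUnique_adj_dist_lt (hG : G.IsTree) {i u : V} (hu : u ≠ i) :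
    ∃! l, G.Adj i l ∧ G.dist l u < G.dist i u := by
  have key {l : V} (hl : G.Adj i l) (hlt : G.dist l u < G.dist i u) :
      ∃ p : G.Path i u, p.1.snd = l := by
    obtain ⟨p, hp⟩ := hG.connected.exists_walk_length_eq_dist l u
    have hle := dist_le (Walk.cons hl p)
    rw [Walk.length_cons] at hle
    exact ⟨⟨Walk.cons hl p, Walk.isPath_of_length_eq_dist _ (by
      rw [Walk.length_cons]; omega)⟩, Walk.snd_cons p hl⟩
  obtain ⟨p, hp⟩ := hG.connected.exists_walk_length_eq_dist i u
  cases p with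
  | nil => exact absurd rfl hu
  | @cons _ l _ hl q =>
    have hq := dist_le q
    rw [Walk.length_cons] at hp
    have hlt : G.dist l u < G.dist i u := by omega
    refine ⟨l, ⟨hl, hlt⟩, fun l' hl' => ?_⟩
    obtain ⟨p₁, rfl⟩ := key hl hlt
    obtain ⟨p₂, rfl⟩ := key hl'.1 hl'.2
    have := hG.isAcyclic.subsingleton_path i u
    rw [Subsingleton.elim p₁ p₂]

lemma IsTree.dist_eq_dist_add_one_of_adj_of_lt (hG : G.IsTree) {i l u : V} (hl : G.Adj i l)
    (hlt : G.dist l u < G.dist i u) : G.dist i u = G.dist l u + 1 := by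
  have h := hG.connected.dist_triangle (u := i) (v := l) (w := u)
  rw [dist_eq_one_iff_adj.mpr hl] at h
  omega

end SimpleGraph

/-- The key inductive claim (steps 2–4) of the finite-time convergence Theorem 2: under the
echo-cancelling message-passing recursion on a finite tree `G`, the message `ψ t i j` from
`i` toward a neighbor `j` aggregates exactly the values `v u` over the vertices `u` lying in
the connected component of `i` after deleting the edge `{i, j}` whose distance from `i` in
`G` is at most `t`. -/
theorem stmt_14 (V : Type*) [Fintype V] (G : SimpleGraph V) [DecidableRel G.Adj]
    (hG : G.IsTree) (M : Type*) [AddCommGroup M] (v : V → M)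
    (ψ : ℕ → V → V → M)
    (hψ0 : ∀ i j : V, G.Adj i j → ψ 0 i j = v i)
    (hψs : ∀ (t : ℕ) (i j : V), G.Adj i j →
      ψ (t + 1) i j = v i + ∑ l ∈ G.neighborFinset i, ψ t l i - ψ t j i) :
    ∀ (t : ℕ) (i j : V), G.Adj i j →
      ψ t i j = ∑ u ∈ Finset.univ.filter
        (fun u : V => (G.deleteEdges {s(i, j)}).Reachable i u ∧ G.dist i u ≤ t), v u := by
  intro t
  induction t with
  | zero =>
    intro i j hij
    rw [hψ0 i j hij, Finset.sum_eq_single_of_mem i (by simp)]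
    intro u hu hui
    have h0 : G.dist i u = 0 := by simpa using (Finset.mem_filter.mp hu).2.2
    exact absurd (hG.connected.dist_eq_zero_iff.mp h0).symm hui
  | succ t ih =>
    intro i j hij
    have msg (l : V) (hl : G.Adj l i) : ψ t l i =
        ∑ u, if G.dist l u < G.dist i u ∧ G.dist l u ≤ t then v u else 0 := by
      rw [ih l i hl, Finset.sum_filter]
      simp only [hG.reachable_deleteEdges_iff_dist_lt hl]
    have hvi : v i = ∑ u, if u = i then v u else 0 := by simp
    rw [hψs t i j hij, msg j hij.symm, Finset.sum_congr rfl
      fun l hl => msg l ((G.mem_neighborFinset i l).mp hl).symm, Finset.sum_comm,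
      Finset.sum_filter, hvi, ← Finset.sum_add_distrib, ← Finset.sum_sub_distrib]
    refine Finset.sum_congr rfl fun u _ => ?_
    simp only [hG.reachable_deleteEdges_iff_dist_lt hij]
    by_cases hu : u = i
    · subst hu
      simp [SimpleGraph.dist_eq_one_iff_adj.mpr hij.symm]
    · obtain ⟨l, ⟨hl, hlt⟩, huniq⟩ := hG.existsUnique_adj_dist_lt hu
      have hdist := hG.dist_eq_dist_add_one_of_adj_of_lt hl hlt
      rw [Finset.sum_eq_single_of_mem l ((G.mem_neighborFinset i l).mpr hl)
        fun l' hl' hne => if_neg fun h =>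
          hne (huniq l' ⟨(G.mem_neighborFinset i l').mp hl', h.1⟩), if_neg hu, zero_add]
      by_cases hjl : j = l
      · subst hjl
        rw [sub_self, if_neg (by omega)]
      · have hnot : ¬ G.dist j u < G.dist i u := fun h => hjl (huniq j ⟨hij, h⟩)
        have hne : G.dist i u ≠ G.dist j u := by
          simpa only [SimpleGraph.dist_comm] using hG.dist_ne_of_adj u hij
        rw [if_neg (c := G.dist j u < G.dist i u ∧ _) fun h => hnot h.1, sub_zero]
        exact if_congr (by omega) rfl rfl
end
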